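/- Let R be an exchange ring. Then R is a weakly ΔU-ring if and only if R is a weakly UJ-ring, i.e., every unit u of R satisfies u = 1 + j or u = -1 + j for some j in the Jacobson radical J(R). -/

import Mathlib

/-- `Δ(R) = {r ∈ R : r + u is a unit for every unit u}`. -/
def Delta (R : Type*) [Ring R] : Set R :=
  {r : R | ∀ u : R, IsUnit u → IsUnit (r + u)}

/-- `R` is a weakly ΔU-ring: every unit is `1 + d` or `-1 + d` with `d ∈ Δ(R)`. -/
def IsWDU (R : Type*) [Ring R] : Prop :=
  ∀ u : R, IsUnit u → ∃ d ∈ Delta R, u = 1 + d ∨ u = -1 + d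

/-- `R` is a ΔU-ring: every unit is `1 + d` with `d ∈ Δ(R)`. -/
def IsDU (R : Type*) [Ring R] : Prop :=
  ∀ u : R, IsUnit u → ∃ d ∈ Delta R, u = 1 + d

/-- `R` is an exchange ring: for each `a` there is an idempotent `e ∈ aR` with
`1 - e ∈ (1 - a)R`. -/
def IsExchange (R : Type*) [Ring R] : Prop :=
  ∀ a : R, ∃ e : R, IsIdempotentElem e ∧ (∃ r : R, e = a * r) ∧
    (∃ s : R, 1 - e = (1 - a) * s)

section aux
variable {R : Type*} [Ring R]

theorem D_neg {d : R} (h : d ∈ Delta R) : -d ∈ Delta R := by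
  intro u hu
  have := (h (-u) hu.neg).neg
  rwa [neg_add, neg_neg] at this

theorem D_add {d d' : R} (h : d ∈ Delta R) (h' : d' ∈ Delta R) : d + d' ∈ Delta R := by
  intro u hu
  rw [add_assoc]
  exact h _ (h' u hu)

theorem D_sub {d d' : R} (h : d ∈ Delta R) (h' : d' ∈ Delta R) : d - d' ∈ Delta R := by
  rw [sub_eq_add_neg]; exact D_add h (D_neg h')

theorem D_mul_unit {d v : R} (h : d ∈ Delta R) (hv : IsUnit v) : d * v ∈ Delta R := by
  intro u hu
  obtain ⟨v, rfl⟩ := hv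
  have := (h (u * ↑v⁻¹) (hu.mul v⁻¹.isUnit)).mul v.isUnit
  rwa [add_mul, Units.inv_mul_cancel_right] at this

theorem D_unit_mul {d v : R} (h : d ∈ Delta R) (hv : IsUnit v) : v * d ∈ Delta R := by
  intro u hu
  obtain ⟨v, rfl⟩ := hv
  have := v.isUnit.mul (h (↑v⁻¹ * u) (v⁻¹.isUnit.mul hu))
  rwa [mul_add, Units.mul_inv_cancel_left] at this

theorem D_mul {d d' : R} (h : d ∈ Delta R) (h' : d' ∈ Delta R) : d * d' ∈ Delta R := by
  have := D_sub (D_mul_unit h (h' 1 isUnit_one)) h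
  rwa [mul_add, mul_one, add_sub_cancel_right] at this

theorem D_idem {p : R} (h : p ∈ Delta R) (hp : p * p = p) : p = 0 := by
  have h1 := h (-1) isUnit_one.neg
  have h2 : (p + -1) * p = 0 := by rw [add_mul, hp]; simp
  exact h1.mul_right_eq_zero.1 h2

theorem D_two (h : (4 : R) ∈ Delta R) : (2 : R) ∈ Delta R := by
  intro u hu
  have h1 := h (-(u * u)) (hu.mul hu).neg
  have h2 : (4 : R) + -(u * u) = (2 + u) * (2 - u) := by
    rw [show (4 : R) = 1 + 1 + 1 + 1 by norm_num, show (2 : R) = 1 + 1 by norm_num]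
    noncomm_ring
  have hc : Commute (2 + u) (2 - u) := by
    show (2 + u) * (2 - u) = (2 - u) * (2 + u)
    noncomm_ring
  rw [h2] at h1
  exact (hc.isUnit_mul_iff.1 h1).1

theorem D_sqz (H : IsWDU R) {x : R} (hx : x * x = 0) : x ∈ Delta R := by
  have e1 : (1 + x) * (1 - x) = 1 := by
    have : (1 + x) * (1 - x) = 1 - x * x := by noncomm_ring
    rw [this, hx, sub_zero]
  have e2 : (1 - x) * (1 + x) = 1 := by
    have : (1 - x) * (1 + x) = 1 - x * x := by noncomm_ring
    rw [this, hx, sub_zero]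
  have u1 : IsUnit (1 + x) := ⟨⟨_, _, e1, e2⟩, rfl⟩
  have u2 : IsUnit (1 - x) := ⟨⟨_, _, e2, e1⟩, rfl⟩
  obtain ⟨d, hd, h | h⟩ := H _ u1
  · rwa [add_left_cancel h]
  obtain ⟨d', hd', h' | h'⟩ := H _ u2
  · rw [sub_eq_add_neg] at h'
    have := D_neg hd'
    rwa [← add_left_cancel h', neg_neg] at this
  have k1 : d = 2 + x := by
    rw [← sub_eq_iff_eq_add'] at h; rw [← h, show (2 : R) = 1 + 1 by norm_num]; noncomm_ring
  have k2 : d' = 2 - x := by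
    rw [← sub_eq_iff_eq_add'] at h'; rw [← h', show (2 : R) = 1 + 1 by norm_num]; noncomm_ring
  have h4 : (4 : R) ∈ Delta R := by
    have := D_add hd hd'
    rw [k1, k2] at this
    convert this using 1
    rw [show (4 : R) = 1 + 1 + 1 + 1 by norm_num, show (2 : R) = 1 + 1 by norm_num]
    noncomm_ring
  have := D_sub hd (D_two h4)
  rw [k1] at this
  simpa using this

theorem D_corner (H : IsWDU R) {e a w : R} (ea : e * a = a) (we : w * e = w)
    (ae : a * e = a) (aw : a * w = e) (ew : e * w = w) : w * a = e := by
  have ee : e * e = e := by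
    nth_rewrite 2 [← aw]
    rw [← mul_assoc, ea, aw]
  obtain ⟨p, hp⟩ : ∃ p, p = e - w * a := ⟨_, rfl⟩
  have ap : a * p = 0 := by rw [hp, mul_sub, ← mul_assoc, aw, ea, ae, sub_self]
  have pw : p * w = 0 := by rw [hp, sub_mul, mul_assoc, aw, we, ew, sub_self]
  have pe : p * e = p := by rw [hp, sub_mul, mul_assoc, ae, ee]
  have pp : p * p = p := by
    nth_rewrite 2 [hp]
    rw [mul_sub, ← mul_assoc, pw, zero_mul, sub_zero, pe]
  have h1 : p * a ∈ Delta R := D_sqz H (by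
    rw [mul_assoc, ← mul_assoc a, ap, zero_mul, mul_zero])
  have h2 : w * p ∈ Delta R := D_sqz H (by
    rw [mul_assoc, ← mul_assoc p, pw, zero_mul, mul_zero])
  have h3 := D_mul h1 h2
  have : p * a * (w * p) = p := by
    rw [mul_assoc, ← mul_assoc a, aw, ← mul_assoc, pe, pp]
  rw [this] at h3
  have := D_idem h3 pp
  rw [hp, sub_eq_zero] at this
  exact this.symm

theorem D_key (H : IsWDU R) {d e r : R} (hd : d ∈ Delta R) (ee : e * e = e)
    (h : e = d * r) : e = 0 := by
  obtain ⟨c, hc⟩ : ∃ c, c = 1 - e := ⟨_, rfl⟩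
  have ec : e * c = 0 := by rw [hc, mul_sub, ee]; simp
  have ce : c * e = 0 := by rw [hc, sub_mul, ee]; simp
  have cc : c * c = c := by nth_rewrite 2 [hc]; rw [mul_sub, ce]; simp
  have c1 : e + c = 1 := by rw [hc]; simp
  have hx : e * d * c ∈ Delta R := D_sqz H (by
    rw [mul_assoc, mul_assoc e, ← mul_assoc c (e * d), ← mul_assoc c e, ce]; simp)
  have hx' : c * d * e ∈ Delta R := D_sqz H (by
    rw [mul_assoc, mul_assoc c, ← mul_assoc e (c * _), ← mul_assoc e c, ec]; simp)
  have hs : c * r * e ∈ Delta R := D_sqz H (by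
    rw [mul_assoc, mul_assoc c, ← mul_assoc e (c * _), ← mul_assoc e c, ec]; simp)
  obtain ⟨t, ht⟩ : ∃ t, t = e * d * c * (c * r * e) := ⟨_, rfl⟩
  have htD : t ∈ Delta R := ht ▸ D_mul hx hs
  have et : e * t = t := by rw [ht]; simp only [← mul_assoc, ee]
  have hk : IsUnit (1 - t) := by
    have := D_neg htD 1 isUnit_one
    rwa [neg_add_eq_sub] at this
  obtain ⟨k, hk⟩ := hk.exists_right_inv
  obtain ⟨a, ha⟩ : ∃ a, a = e * d * e := ⟨_, rfl⟩
  have ea : e * a = a := by rw [ha]; simp only [← mul_assoc, ee]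
  have ae : a * e = a := by rw [ha]; simp only [mul_assoc, ee]
  have h0 : a * (e * r * e) = e * (1 - t) := by
    have h1 : e * d * (e + c) * r * e = e := by
      rw [c1, mul_one, mul_assoc e d r, ← h, ee, ee]
    have h2 : e * d * (e + c) * r * e = e * d * (e * e) * r * e + e * d * (c * c) * r * e := by
      rw [ee, cc]; noncomm_ring
    have h3 : e * d * (e * e) * r * e = a * (e * r * e) := by
      rw [ha]; simp only [mul_assoc]
    have h4 : e * d * (c * c) * r * e = t := by
      rw [ht]; simp only [mul_assoc]
    rw [h1, h3, h4] at h2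
    rw [mul_sub, mul_one, et]
    exact (sub_eq_of_eq_add h2).symm
  obtain ⟨w, hw⟩ : ∃ w, w = e * r * e * k * e := ⟨_, rfl⟩
  have ew : e * w = w := by rw [hw]; simp only [← mul_assoc, ee]
  have we : w * e = w := by rw [hw]; simp only [mul_assoc, ee]
  have aw : a * w = e := by
    rw [hw, ← mul_assoc, ← mul_assoc, h0, mul_assoc e, hk, mul_one, ee]
  have wa := D_corner H ea we ae aw ew
  have ac : a * c = 0 := by rw [← ae, mul_assoc, ec, mul_zero]
  have ca : c * a = 0 := by rw [← ea, ← mul_assoc, ce, zero_mul]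
  have wc : w * c = 0 := by rw [← we, mul_assoc, ec, mul_zero]
  have cw : c * w = 0 := by rw [← ew, ← mul_assoc, ce, zero_mul]
  have uv : IsUnit (w + c) := ⟨⟨w + c, a + c, by
    rw [add_mul, mul_add, mul_add, wa, wc, ca, cc]; simpa using c1, by
    rw [add_mul, mul_add, mul_add, aw, ac, cw, cc]; simpa using c1⟩, rfl⟩
  have hd1 : a + c * d * c ∈ Delta R := by
    have := D_sub (D_sub hd hx) hx'
    convert this using 1
    rw [ha, hc]; noncomm_ring
  have h5 := D_unit_mul hd1 uv (-1) isUnit_one.neg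
  refine h5.mul_right_eq_zero.1 ?_
  have : (w + c) * (a + c * d * c) * e = e := by
    rw [mul_assoc, add_mul a, ae, mul_assoc _ c e, ce, mul_zero, add_zero, add_mul, wa, ca, add_zero]
  rw [add_mul, this]; simp

theorem D_jac (hex : IsExchange R) (H : IsWDU R) {d : R} (hd : d ∈ Delta R) (y : R) :
    IsUnit (1 - y * d) := by
  obtain ⟨e, he, ⟨r, hr⟩, s, hs⟩ := hex (d * y)
  have e0 : e = 0 := D_key H hd he (r := y * r) (by rw [hr, mul_assoc])
  rw [e0, sub_zero] at hs
  have h2 : s * (1 - d * y) = 1 :=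
    D_corner H (one_mul _) (mul_one _) (mul_one _) hs.symm (one_mul _)
  have p1 : s - d * y * s = 1 := by rw [hs]; noncomm_ring
  have p2 : s - s * (d * y) = 1 := by rw [← h2]; noncomm_ring
  refine ⟨⟨1 - y * d, 1 + y * s * d, ?_, ?_⟩, rfl⟩
  · have : (1 - y * d) * (1 + y * s * d) = 1 - y * d + y * (s - d * y * s) * d := by noncomm_ring
    rw [this, p1]; simp
  · have : (1 + y * s * d) * (1 - y * d) = 1 - y * d + y * (s - s * (d * y)) * d := by noncomm_ring
    rw [this, p2]; simp

end aux

/-- An exchange ring is weakly ΔU iff it is weakly UJ, i.e. every unit is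
`1 + j` or `-1 + j` with `j ∈ J(R)` (where `j ∈ J(R)` iff `1 - y * j` is a unit for all `y`). -/
theorem stmt_17 (R : Type*) [Ring R] (hex : IsExchange R) :
    IsWDU R ↔
      ∀ u : R, IsUnit u → ∃ j : R, (∀ y : R, IsUnit (1 - y * j)) ∧
        (u = 1 + j ∨ u = -1 + j) := by
  constructor
  · intro H u hu
    obtain ⟨d, hd, h⟩ := H u hu
    exact ⟨d, D_jac hex H hd, h⟩
  · intro H u hu
    obtain ⟨j, hj, h⟩ := H u hu
    refine ⟨j, ?_, h⟩
    intro v hv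
    obtain ⟨v, rfl⟩ := hv
    have := v.isUnit.mul (hj (-↑v⁻¹))
    rw [neg_mul, sub_neg_eq_add, mul_add, mul_one, Units.mul_inv_cancel_left, add_comm] at this
    exact this
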